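/- The group E_H(1) equals the subgroup {id_H, ι} of Aut(H) generated by the inversion automorphism ι; that is, an automorphism σ of H acts trivially on J/J² if and only if σ is the identity or σ = ι. In particular E_H(1) is cyclic of order 2. -/

import Mathlib

set_option synthInstance.maxHeartbeats 1000000
set_option maxHeartbeats 1000000

noncomputable section

abbrev SL2 : Type := Matrix.SpecialLinearGroup (Fin 2) ℂ

/-- The free abelian group of rank `n`, written multiplicatively. -/
abbrev H (n : ℕ) : Type := Multiplicative (Fin n → ℤ)

/-- The algebra of complex-valued functions on the representation space `R(H)`. -/
abbrev FR (n : ℕ) : Type := (H n →* SL2) → ℂ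

/-- The standard basis element `x_i` of `H`. -/
def xgen (n : ℕ) (i : Fin n) : H n := Multiplicative.ofAdd (Pi.single i 1)

/-- The Fricke character `tr x`. -/
def trc {n : ℕ} (x : H n) : FR n :=
  fun ρ => Matrix.trace ((ρ x : Matrix (Fin 2) (Fin 2) ℂ))

/-- The ring of Fricke characters `𝔛_ℚ(H)`. -/
def Xring (n : ℕ) : Subalgebra ℚ (FR n) :=
  Algebra.adjoin ℚ {f : FR n | ∃ x : H n, f = trc x}

/-- The ideal `J` generated by all `tr' x = tr x - 2`. -/
def Jideal (n : ℕ) : Ideal (Xring n) :=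
  Ideal.span {f : Xring n | ∃ x : H n, (f : FR n) = trc x - 2}

/-- `tr' x = tr x - 2` as an element of `𝔛_ℚ(H)`. -/
def trc' {n : ℕ} (x : H n) : Xring n :=
  ⟨trc x - 2, sub_mem (Algebra.subset_adjoin ⟨x, rfl⟩) (ofNat_mem _ 2)⟩

/-- The right action of `σ ∈ Aut(H)` on `F(R(H),ℂ)`: `χ^σ(ρ) := χ(ρ^{σ⁻¹})`, i.e.
`χ^σ = fun ρ => χ (ρ ∘ σ)`, as a ring homomorphism. -/
def actRH (n : ℕ) (σ : MulAut (H n)) : FR n →+* FR n where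
  toFun χ := fun ρ => χ (ρ.comp σ.toMonoidHom)
  map_one' := rfl
  map_mul' _ _ := rfl
  map_zero' := rfl
  map_add' _ _ := rfl

/-- `E_H(k)`: the set of automorphisms of `H` acting trivially on `J/J^{k+1}`, i.e. those `σ`
with `f^σ - f ∈ J^{k+1}` for every `f ∈ J`. -/
def EH (n k : ℕ) : Set (MulAut (H n)) :=
  {σ | ∀ f : Xring n, f ∈ Jideal n →
    actRH n σ (f : FR n) - (f : FR n) ∈
      Subtype.val '' ((Jideal n ^ (k + 1) : Ideal (Xring n)) : Set (Xring n))}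

/-- The inversion automorphism `ι : x_i ↦ x_i⁻¹`. -/
def inv_aut (n : ℕ) : MulAut (H n) := MulEquiv.inv (H n)

lemma hasDerivAt_sinh_mul_const (c : ℂ) :
    HasDerivAt (fun s : ℂ => Complex.sinh (s * c)) c 0 := by
  simpa using ((hasDerivAt_id (0 : ℂ)).mul_const c).csinh

open Asymptotics Topology in
lemma isBigO_sinh_mul_const (c : ℂ) :
    (fun s : ℂ => Complex.sinh (s * c)) =O[𝓝 0] fun s => s := by
  simpa using (hasDerivAt_sinh_mul_const c).isBigO_sub

/-- The diagonal matrix with entries `exp z` and `exp (-z)`. -/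
def diagExp (z : ℂ) : SL2 :=
  ⟨!![Complex.exp z, 0; 0, Complex.exp (-z)], by
    rw [Matrix.det_fin_two_of, ← Complex.exp_add]; simp⟩

lemma coe_diagExp (z : ℂ) :
    (diagExp z : Matrix (Fin 2) (Fin 2) ℂ) = !![Complex.exp z, 0; 0, Complex.exp (-z)] := rfl

lemma diagExp_add (z w : ℂ) : diagExp (z + w) = diagExp z * diagExp w := by
  apply Subtype.ext
  rw [Matrix.SpecialLinearGroup.coe_mul, coe_diagExp, coe_diagExp, coe_diagExp, neg_add,
    Complex.exp_add, Complex.exp_add, Matrix.mul_fin_two]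
  simp

/-- The one-parameter family of diagonal representations of `H` with direction `v`. -/
def diagRep {n : ℕ} (v : Fin n → ℤ) (s : ℂ) : H n →* SL2 :=
  MonoidHom.mk' (fun x => diagExp (s * ((x.toAdd ⬝ᵥ v : ℤ) : ℂ))) fun x y => by
    rw [toAdd_mul, add_dotProduct, Int.cast_add, mul_add, diagExp_add]

lemma diagRep_apply {n : ℕ} (v : Fin n → ℤ) (s : ℂ) (x : H n) :
    diagRep v s x = diagExp (s * ((x.toAdd ⬝ᵥ v : ℤ) : ℂ)) := rfl

lemma trc_diagRep {n : ℕ} (v : Fin n → ℤ) (s : ℂ) (x : H n) :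
    trc x (diagRep v s) = 2 * Complex.cosh (s * ((x.toAdd ⬝ᵥ v : ℤ) : ℂ)) := by
  rw [trc, diagRep_apply, coe_diagExp, Matrix.trace_fin_two_of, Complex.two_cosh]

lemma continuous_diagRep {n : ℕ} (v : Fin n → ℤ) {f : FR n} (hf : f ∈ Xring n) :
    Continuous fun s => f (diagRep v s) := by
  induction hf using Algebra.adjoin_induction with
  | mem f hf =>
    obtain ⟨x, rfl⟩ := hf
    simp only [trc_diagRep]
    fun_prop
  | algebraMap r => exact continuous_const
  | add f g _ _ hf hg => exact hf.add hg
  | mul f g _ _ hf hg => exact hf.mul hg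

open Asymptotics Topology in
lemma isBigO_one_of_mem_Xring {n : ℕ} (v : Fin n → ℤ) (f : Xring n) :
    (fun s => (f : FR n) (diagRep v s)) =O[𝓝 0] fun _ => (1 : ℂ) :=
  ((continuous_diagRep v f.2).tendsto 0).isBigO_one ℂ

open Asymptotics Topology in
lemma isBigO_sq_of_mem_Jideal {n : ℕ} (v : Fin n → ℤ) {f : Xring n} (hf : f ∈ Jideal n) :
    (fun s => (f : FR n) (diagRep v s)) =O[𝓝 0] fun s => s ^ 2 := by
  induction hf using Submodule.span_induction with
  | mem f hf =>
    obtain ⟨x, hx⟩ := hf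
    have h := ((isBigO_sinh_mul_const (((x.toAdd ⬝ᵥ v : ℤ) : ℂ) / 2)).pow 2).const_mul_left 4
    refine h.congr_left fun s => ?_
    have h2 := Complex.cosh_two_mul (s * (((x.toAdd ⬝ᵥ v : ℤ) : ℂ) / 2))
    rw [show 2 * (s * (((x.toAdd ⬝ᵥ v : ℤ) : ℂ) / 2)) = s * ((x.toAdd ⬝ᵥ v : ℤ) : ℂ) by ring,
      Complex.cosh_sq] at h2
    rw [hx, Pi.sub_apply, trc_diagRep, h2]
    simp only [Pi.ofNat_apply]
    ring
  | zero => exact isBigO_zero _ _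
  | add f g _ _ hf hg => exact hf.add hg
  | smul a f _ hf => simpa using (isBigO_one_of_mem_Xring v a).mul hf

open Asymptotics Topology in
lemma isBigO_pow_four_of_mem_Jideal_sq {n : ℕ} (v : Fin n → ℤ) {f : Xring n}
    (hf : f ∈ Jideal n ^ 2) :
    (fun s => (f : FR n) (diagRep v s)) =O[𝓝 0] fun s => s ^ 4 := by
  rw [pow_two] at hf
  induction hf using Submodule.mul_induction_on' with
  | mem_mul_mem f hf g hg =>
    exact ((isBigO_sq_of_mem_Jideal v hf).mul (isBigO_sq_of_mem_Jideal v hg)).congr_right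
      fun s => by ring
  | add f _ g _ hf hg => exact hf.add hg

open Asymptotics Filter Topology in
lemma mul_eq_zero_of_isBigO_cosh_sub {a b : ℂ}
    (h : (fun s : ℂ => 2 * Complex.cosh (s * a) - 2 * Complex.cosh (s * b)) =O[𝓝 0]
      fun s => s ^ 4) : (a - b) * (a + b) = 0 := by
  have slope (c : ℂ) : Tendsto (fun s : ℂ => s⁻¹ * Complex.sinh (s * c)) (𝓝[≠] 0) (𝓝 c) := by
    simpa using (hasDerivAt_sinh_mul_const c).tendsto_slope_zero
  have lim := ((slope ((a - b) / 2)).mul (slope ((a + b) / 2))).const_mul 4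
  have lim0 : Tendsto (fun s : ℂ => (s ^ 2)⁻¹ *
      (2 * Complex.cosh (s * a) - 2 * Complex.cosh (s * b))) (𝓝[≠] 0) (𝓝 0) := by
    have hO := (isBigO_refl (fun s : ℂ => (s ^ 2)⁻¹) (𝓝[≠] 0)).mul
      (h.mono nhdsWithin_le_nhds)
    refine hO.trans_tendsto ?_
    have hs : Tendsto (fun s : ℂ => s ^ 2) (𝓝[≠] 0) (𝓝 0) :=
      ((continuous_pow 2).tendsto' (0 : ℂ) 0 (by simp)).mono_left nhdsWithin_le_nhds
    refine hs.congr' ?_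
    filter_upwards [self_mem_nhdsWithin] with s hs
    have : s ≠ 0 := hs
    field_simp
  have key : 4 * ((a - b) / 2 * ((a + b) / 2)) = 0 := by
    refine tendsto_nhds_unique lim (lim0.congr fun s => ?_)
    rw [show s * a = s * ((a + b) / 2) + s * ((a - b) / 2) by ring,
      show s * b = s * ((a + b) / 2) - s * ((a - b) / 2) by ring,
      Complex.cosh_add, Complex.cosh_sub]
    ring
  linear_combination key

lemma eq_zero_or_eq_zero_of_dotProduct_mul_eq_zero {n : ℕ} {p q : Fin n → ℤ}
    (h : ∀ v, (p ⬝ᵥ v) * (q ⬝ᵥ v) = 0) : p = 0 ∨ q = 0 := by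
  by_contra! hpq
  have hp : p ⬝ᵥ p ≠ 0 := dotProduct_self_eq_zero.not.mpr hpq.1
  have hq : q ⬝ᵥ q ≠ 0 := dotProduct_self_eq_zero.not.mpr hpq.2
  have h0 : q ⬝ᵥ p = 0 := (mul_eq_zero.mp (h p)).resolve_left hp
  have h1 := h (p + q)
  rw [dotProduct_add, dotProduct_add, dotProduct_comm p q, h0, add_zero, zero_add] at h1
  exact (mul_ne_zero hp hq) h1

lemma trc_inv {n : ℕ} (x : H n) : trc x⁻¹ = trc x := by
  funext ρ
  simp [trc, Matrix.SpecialLinearGroup.coe_inv, Matrix.adjugate_fin_two, Matrix.trace_fin_two,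
    add_comm]

lemma actRH_trc {n : ℕ} (σ : MulAut (H n)) (x : H n) : actRH n σ (trc x) = trc (σ x) := rfl

lemma actRH_inv_aut {n : ℕ} {f : FR n} (hf : f ∈ Xring n) : actRH n (inv_aut n) f = f := by
  induction hf using Algebra.adjoin_induction with
  | mem f hf =>
    obtain ⟨x, rfl⟩ := hf
    exact trc_inv x
  | algebraMap r => rfl
  | add f g _ _ hf hg => rw [map_add, hf, hg]
  | mul f g _ _ hf hg => rw [map_mul, hf, hg]

lemma apply_eq_or_eq_inv_of_mem_EH {n : ℕ} {σ : MulAut (H n)} (hσ : σ ∈ EH n 1) (x : H n) :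
    σ x = x ∨ σ x = x⁻¹ := by
  obtain ⟨g, hg, hgx⟩ := hσ (trc' x) (Ideal.subset_span ⟨x, rfl⟩)
  have hg' : (g : FR n) = trc (σ x) - trc x := by
    rw [hgx, trc', map_sub, actRH_trc, map_ofNat]
    ring
  have h : (σ x).toAdd - x.toAdd = 0 ∨ (σ x).toAdd + x.toAdd = 0 := by
    refine eq_zero_or_eq_zero_of_dotProduct_mul_eq_zero fun v => ?_
    have hO := isBigO_pow_four_of_mem_Jideal_sq v hg
    simp only [hg', Pi.sub_apply, trc_diagRep] at hO
    have := mul_eq_zero_of_isBigO_cosh_sub hO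
    rw [sub_dotProduct, add_dotProduct]
    exact_mod_cast this
  exact h.imp (fun h => Multiplicative.toAdd.injective (sub_eq_zero.mp h))
    fun h => Multiplicative.toAdd.injective (eq_neg_of_add_eq_zero_left h)

lemma eq_refl_or_eq_inv_aut {n : ℕ} {σ : MulAut (H n)} (h : ∀ x, σ x = x ∨ σ x = x⁻¹) :
    σ = MulEquiv.refl (H n) ∨ σ = inv_aut n := by
  by_contra! hne
  obtain ⟨x, hx⟩ := DFunLike.ne_iff.mp hne.1
  obtain ⟨y, hy⟩ := DFunLike.ne_iff.mp hne.2
  replace hx : σ x ≠ x := hx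
  replace hy : σ y ≠ y⁻¹ := hy
  have hx' := (h x).resolve_left hx
  have hy' := (h y).resolve_right hy
  rw [hx'] at hx
  rw [hy'] at hy
  have hxy := h (x * y)
  rw [map_mul, hx', hy', mul_inv] at hxy
  exact hxy.elim (fun e => hx (mul_right_cancel e)) (fun e => hy (mul_left_cancel e))

lemma inv_aut_ne_refl {n : ℕ} (hn : 1 ≤ n) : inv_aut n ≠ MulEquiv.refl (H n) := by
  intro h
  have h1 := congrArg (fun y : H n => y.toAdd ⟨0, hn⟩) (DFunLike.congr_fun h (xgen n ⟨0, hn⟩))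
  simp [inv_aut, xgen] at h1

/-- **Proposition 5.1**: `E_H(1) = {id, ι}`; moreover `ι ≠ id`, so `E_H(1)` is the cyclic group
of order 2 generated by the inversion automorphism `ι`. -/
theorem EH_one_eq (n : ℕ) (hn : 1 ≤ n) :
    EH n 1 = {MulEquiv.refl (H n), inv_aut n} ∧ inv_aut n ≠ MulEquiv.refl (H n) := by
  refine ⟨Set.Subset.antisymm (fun σ hσ => ?_) ?_, inv_aut_ne_refl hn⟩
  · exact eq_refl_or_eq_inv_aut (apply_eq_or_eq_inv_of_mem_EH hσ)
  · rintro σ (rfl | rfl) f -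
    · exact ⟨0, zero_mem _, (sub_self (f : FR n)).symm⟩
    · exact ⟨0, zero_mem _, by rw [actRH_inv_aut f.2, sub_self]; rfl⟩
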